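/- Let K be a field and ζ ∈ K an element of multiplicative order 5. Let F ∈ K[X, Y, Z] be a homogeneous polynomial of degree 5 satisfying both F(X, ζ·Y, ζ⁴·Z) = F(X, Y, Z) and F(X, ζ·Z, ζ⁴·Y) = F(X, Y, Z), and suppose F(1, 0, 0) = 0. Then there exist a₁, a₃, a₄ ∈ K such that F = a₁·(Y⁵ + Z⁵) + a₃·X·Y²·Z² + a₄·X³·Y·Z. (This is the model of the singular plane quintic of a genus-5 trigonal curve with automorphism group D₅, with singular point [1 : 0 : 0].) -/

import Mathlib

open MvPolynomial

/-- Rescaling the variables rescales the coefficients. -/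
theorem coeff_aeval_C_mul_X {σ R : Type*} [CommSemiring R] (a : σ → R) (F : MvPolynomial σ R)
    (d : σ →₀ ℕ) :
    coeff d (aeval (fun i => C (a i) * (X i : MvPolynomial σ R)) F)
      = (d.prod fun i n => a i ^ n) * coeff d F := by
  classical
  induction F using MvPolynomial.induction_on' with
  | monomial e r =>
    have h : aeval (fun i => C (a i) * (X i : MvPolynomial σ R)) (monomial e r)
        = monomial e ((e.prod fun i n => a i ^ n) * r) := by
      rw [aeval_monomial, monomial_eq (a := _ * r)]
      simp only [mul_pow, Finsupp.prod_mul, algebraMap_eq, C_mul, ← C_pow]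
      rw [Finsupp.prod, Finsupp.prod, Finsupp.prod, map_prod]
      ring
    rw [h, coeff_monomial, coeff_monomial]
    split_ifs with hed
    · rw [hed]
    · simp
  | add p q hp hq => rw [map_add, coeff_add, hp, hq, coeff_add, mul_add]

/-- The exponent vector of `X 0 ^ a * X 1 ^ b * X 2 ^ c`. -/
noncomputable def ternaryExponent (a b c : ℕ) : Fin 3 →₀ ℕ :=
  Finsupp.equivFunOnFinite.symm ![a, b, c]

theorem eq_ternaryExponent (d : Fin 3 →₀ ℕ) : d = ternaryExponent (d 0) (d 1) (d 2) := by
  ext i; fin_cases i <;> rfl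

theorem ternaryExponent_inj {a b c a' b' c' : ℕ} :
    ternaryExponent a b c = ternaryExponent a' b' c' ↔ a = a' ∧ b = b' ∧ c = c' := by
  simp [ternaryExponent]

theorem prod_ternaryExponent {M : Type*} [CommMonoid M] (a b c : ℕ) (x : Fin 3 → M) :
    ((ternaryExponent a b c).prod fun i n => x i ^ n) = x 0 ^ a * x 1 ^ b * x 2 ^ c := by
  rw [Finsupp.prod_fintype _ _ (by simp), Fin.prod_univ_three]
  rfl

theorem monomial_ternaryExponent {R : Type*} [CommSemiring R] (a b c : ℕ) (r : R) :
    monomial (ternaryExponent a b c) r = C r * (X 0 ^ a * X 1 ^ b * X 2 ^ c) := by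
  rw [monomial_eq, prod_ternaryExponent]

/-- A quintic form invariant under `(X, Y, Z) ↦ (X, ζY, ζ⁴Z)` with `ζ` of order `5`. -/
theorem eq_of_aeval_diagonal_eq (K : Type*) [Field K] (ζ : K) (hζ : orderOf ζ = 5)
    (F : MvPolynomial (Fin 3) K) (hhom : F.IsHomogeneous 5)
    (hinv : aeval ![(X 0 : MvPolynomial (Fin 3) K), C ζ * X 1, C (ζ ^ 4) * X 2] F = F) :
    ∃ a₀ a₁ a₂ a₃ a₄ : K,
      F = C a₀ * X 0 ^ 5 + C a₁ * X 1 ^ 5 + C a₂ * X 2 ^ 5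
        + C a₃ * (X 0 * X 1 ^ 2 * X 2 ^ 2) + C a₄ * (X 0 ^ 3 * X 1 * X 2) := by
  classical
  have hdiag : ![(X 0 : MvPolynomial (Fin 3) K), C ζ * X 1, C (ζ ^ 4) * X 2]
      = fun i => C (![1, ζ, ζ ^ 4] i) * X i := by
    ext1 i; fin_cases i <;> simp
  have hsupp : F.support ⊆ {ternaryExponent 5 0 0, ternaryExponent 0 5 0, ternaryExponent 0 0 5,
      ternaryExponent 1 2 2, ternaryExponent 3 1 1} := by
    intro d hd
    rw [mem_support_iff] at hd
    have hdeg : d 0 + d 1 + d 2 = 5 := by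
      rw [← hhom hd, Finsupp.weight_apply, Finsupp.sum_fintype _ _ (by simp),
        Fin.sum_univ_three]
      simp
    have hmod : 5 ∣ d 1 + 4 * d 2 := by
      have h := coeff_aeval_C_mul_X ![1, ζ, ζ ^ 4] F d
      rw [← hdiag, hinv, eq_comm, mul_eq_right₀ hd, eq_ternaryExponent d,
        prod_ternaryExponent] at h
      rw [← hζ, orderOf_dvd_iff_pow_eq_one, pow_add, pow_mul]
      simpa using h
    rw [eq_ternaryExponent d]
    simp only [Finset.mem_insert, Finset.mem_singleton, ternaryExponent_inj]
    have : d 2 ≤ 5 := by omega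
    generalize d 0 = a, d 1 = b, d 2 = c at *
    interval_cases c <;> omega
  refine ⟨coeff (ternaryExponent 5 0 0) F, coeff (ternaryExponent 0 5 0) F,
    coeff (ternaryExponent 0 0 5) F, coeff (ternaryExponent 1 2 2) F,
    coeff (ternaryExponent 3 1 1) F, F.as_sum.trans ((Finset.sum_subset hsupp fun d _ hd => by
    rw [notMem_support_iff.mp hd, monomial_zero]).trans ?_)⟩
  rw [Finset.sum_insert, Finset.sum_insert, Finset.sum_insert, Finset.sum_insert,
    Finset.sum_singleton]
  · simp only [monomial_ternaryExponent, pow_zero, pow_one, mul_one, one_mul, ← add_assoc]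
  all_goals simp [ternaryExponent_inj]

/-- Let `ζ ∈ K` have multiplicative order `5`. A quintic homogeneous
`F ∈ K[X,Y,Z]` with `F(X, ζY, ζ⁴Z) = F = F(X, ζZ, ζ⁴Y)` and `F(1,0,0) = 0`
has the form `a₁(Y⁵ + Z⁵) + a₃ XY²Z² + a₄ X³YZ`. -/
theorem stmt15 (K : Type*) [Field K] (ζ : K) (hζ : orderOf ζ = 5)
    (F : MvPolynomial (Fin 3) K) (hhom : F.IsHomogeneous 5)
    (hinv₁ : aeval ![(X 0 : MvPolynomial (Fin 3) K), C ζ * X 1, C (ζ ^ 4) * X 2] F = F)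
    (hinv₂ : aeval ![(X 0 : MvPolynomial (Fin 3) K), C ζ * X 2, C (ζ ^ 4) * X 1] F = F)
    (hsing : eval ![(1 : K), 0, 0] F = 0) :
    ∃ a₁ a₃ a₄ : K,
      F = C a₁ * (X 1 ^ 5 + X 2 ^ 5)
        + C a₃ * (X 0 * X 1 ^ 2 * X 2 ^ 2) + C a₄ * (X 0 ^ 3 * X 1 * X 2) := by
  obtain ⟨a₀, a₁, a₂, a₃, a₄, rfl⟩ := eq_of_aeval_diagonal_eq K ζ hζ F hhom hinv₁
  have h₀ : a₀ = 0 := by simpa using hsing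
  have h₁ : a₁ = a₂ := by
    have hζ5 : (ζ ^ 4) ^ 5 = 1 := by
      rw [← pow_mul, mul_comm, pow_mul, ← hζ, pow_orderOf_eq_one, one_pow]
    have h := congrArg (eval ![(0 : K), 1, 0]) hinv₂
    simp [h₀, mul_pow, hζ5] at h
    exact h.symm
  refine ⟨a₁, a₃, a₄, ?_⟩
  rw [h₀, ← h₁, C_0]
  ring
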